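/- Under the front-door assumptions with binary treatment and binary mediator, the average causal effect of treatment on the outcome is identified by the front-door functional: E[(M_1 − M_0)·(Ẏ_1 − Ẏ_0)] = E[ (p_1 − p_0)·(γ_1 − γ_0) ]. -/

import Mathlib

open MeasureTheory ProbabilityTheory Filter

/-- Conditional independence of `f` and `g` given the sub-σ-algebra `m`, characterized via
bounded measurable test functions: for all bounded measurable `φ ψ`,
`E[φ(f) ψ(g) | m] = E[φ(f) | m] · E[ψ(g) | m]` almost everywhere. -/
def CondIndepFun' {Ω α β : Type*} {m0 : MeasurableSpace Ω} [MeasurableSpace α]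
    [MeasurableSpace β] (m : MeasurableSpace Ω) (μ : @MeasureTheory.Measure Ω m0)
    (f : Ω → α) (g : Ω → β) : Prop :=
  ∀ (φ : α → ℝ) (ψ : β → ℝ), Measurable φ → Measurable ψ →
    (∃ B : ℝ, ∀ x, |φ x| ≤ B) → (∃ B : ℝ, ∀ x, |ψ x| ≤ B) →
    (μ[fun ω => φ (f ω) * ψ (g ω)|m]) =ᵐ[μ]
      fun ω => (μ[fun ω' => φ (f ω')|m]) ω * (μ[fun ω' => ψ (g ω')|m]) ω


lemma fd_pull {Ω : Type*} {m m0 : MeasurableSpace Ω} (hm : m ≤ m0) (P : Measure Ω)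
    [IsProbabilityMeasure P] {X F : Ω → ℝ} {c : ℝ} (hX : StronglyMeasurable[m] X)
    (hXb : ∀ᵐ ω ∂P, ‖X ω‖ ≤ c) (hF : Integrable F P) :
    P[fun ω => F ω * X ω|m] =ᵐ[P] fun ω => P[F|m] ω * X ω :=
  condExp_mul_of_stronglyMeasurable_right hX
    (hF.mul_bdd (hX.mono hm).aestronglyMeasurable hXb) hF

lemma fd_bdd {Ω : Type*} {m m0 : MeasurableSpace Ω} (P : Measure Ω)
    {X : Ω → ℝ} (hXb : ∀ ω, |X ω| ≤ 1) :
    ∀ᵐ ω ∂P, ‖P[X|m] ω‖ ≤ 1 := by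
  have := ae_bdd_condExp_of_ae_bdd (m := m) (μ := P) (R := 1) (f := X)
    (Eventually.of_forall fun ω => by simpa using hXb ω)
  simpa using this

lemma fd_ci {Ω α β : Type*} {m m0 : MeasurableSpace Ω} [MeasurableSpace α] [MeasurableSpace β]
    (hm : m ≤ m0) (P : Measure Ω) [IsProbabilityMeasure P] {f : Ω → α} {g : Ω → β}
    (hf : Measurable f) (hg : Measurable g)
    (h : CondIndepFun' m P f g) {φ : α → ℝ} {ψ : β → ℝ} (hφ : Measurable φ) (hψ : Measurable ψ)
    (hφi : Integrable (fun ω => φ (f ω)) P) (hψb : ∀ ω, |ψ (g ω)| ≤ 1) :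
    P[fun ω => φ (f ω) * ψ (g ω)|m] =ᵐ[P]
      fun ω => P[fun ω => φ (f ω)|m] ω * P[fun ω => ψ (g ω)|m] ω := by
  have hE := fd_bdd (m := m) P hψb
  refine EventuallyEq.trans ?_ (fd_pull hm P stronglyMeasurable_condExp hE hφi)
  have hψg : AEStronglyMeasurable (fun ω => ψ (g ω)) P :=
    (hψ.comp hg).aestronglyMeasurable
  have hEm : AEStronglyMeasurable (P[fun ω => ψ (g ω)|m]) P :=
    (stronglyMeasurable_condExp.mono hm).aestronglyMeasurable
  let T : ℕ → α → ℝ := fun n x => max (-(n:ℝ)) (min (n:ℝ) (φ x))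
  have hTm : ∀ n, Measurable (T n) := fun n => measurable_const.max (measurable_const.min hφ)
  have hTb : ∀ n x, |T n x| ≤ |φ x| := by
    intro n x
    have hn : (0:ℝ) ≤ n := n.cast_nonneg
    simp only [T]
    rcases max_cases (-(n:ℝ)) (min (n:ℝ) (φ x)) with h | h <;>
    rcases min_cases (n:ℝ) (φ x) with h' | h' <;>
    rcases abs_cases (φ x) with h'' | h'' <;>
    rw [abs_le] <;> constructor <;> linarith
  have hTn : ∀ n x, |T n x| ≤ n := by
    intro n x
    have hn : (0:ℝ) ≤ n := n.cast_nonneg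
    rw [abs_le]
    exact ⟨le_max_left _ _, max_le (by linarith) (min_le_left _ _)⟩
  have hTt : ∀ x, Tendsto (fun n => T n x) atTop (nhds (φ x)) := by
    intro x
    obtain ⟨N, hN⟩ := exists_nat_ge |φ x|
    refine tendsto_const_nhds.congr' ?_
    filter_upwards [eventually_ge_atTop N] with n hn
    have h1 : |φ x| ≤ n := hN.trans (by exact_mod_cast hn)
    rw [abs_le] at h1
    simp only [T]
    rw [min_eq_right h1.2, max_eq_right h1.1]
  have hTi : ∀ n, Integrable (fun ω => T n (f ω)) P := fun n =>
    hφi.mono ((hTm n).comp hf).aestronglyMeasurable (Eventually.of_forall fun ω => hTb n _)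
  have hψn : ∀ᵐ ω ∂P, ‖ψ (g ω)‖ ≤ 1 := Eventually.of_forall hψb
  refine tendsto_condExp_unique (fun n ω => T n (f ω) * ψ (g ω))
    (fun n ω => T n (f ω) * P[fun ω => ψ (g ω)|m] ω) _ _
    (fun n => (hTi n).mul_bdd hψg hψn) (fun n => (hTi n).mul_bdd hEm hE)
    (Eventually.of_forall fun ω => (hTt _).mul_const _)
    (Eventually.of_forall fun ω => (hTt _).mul_const _)
    (fun ω => |φ (f ω)|) hφi.abs (fun ω => |φ (f ω)|) hφi.abs ?_ ?_ ?_
  · intro n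
    filter_upwards [hψn] with ω h1
    rw [norm_mul]
    exact (mul_le_of_le_one_right (norm_nonneg _) h1).trans (hTb n _)
  · intro n
    filter_upwards [hE] with ω h1
    rw [norm_mul]
    exact (mul_le_of_le_one_right (norm_nonneg _) h1).trans (hTb n _)
  · intro n
    refine EventuallyEq.trans ?_ (fd_pull hm P stronglyMeasurable_condExp hE (hTi n)).symm
    have hc : ∀ ω, max (-1) (min 1 (ψ (g ω))) = ψ (g ω) := by
      intro ω
      have := abs_le.1 (hψb ω)
      rw [min_eq_right this.2, max_eq_right this.1]
    have := h (T n) (fun x => max (-1) (min 1 (ψ x))) (hTm n)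
      (measurable_const.max (measurable_const.min hψ)) ⟨n, hTn n⟩
      ⟨1, fun x => abs_le.2 ⟨le_max_left _ _, max_le (by norm_num) (min_le_left _ _)⟩⟩
    simpa only [hc] using this

lemma fd_L1 {Ω 𝓒 : Type*} [MeasurableSpace 𝓒] {G H m0 : MeasurableSpace Ω} (P : Measure Ω)
    [IsProbabilityMeasure P] {A : Ω → ℝ} {C : Ω → 𝓒} (hA : Measurable A) (hC : Measurable C)
    (hG : G = MeasurableSpace.comap C inferInstance)
    (hH : H = MeasurableSpace.comap (fun ω => (A ω, C ω)) inferInstance)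
    (hGm : G ≤ m0) (hHm : H ≤ m0)
    (a : ℝ) {I J : Ω → ℝ} (hI : I = fun ω => if A ω = a then (1:ℝ) else 0)
    (hIH : StronglyMeasurable[H] I)
    (hJm : Measurable J) (hJb : ∀ ω, |J ω| ≤ 1) :
    P[fun ω => J ω * I ω * P[I|G] ω|H] =ᵐ[P] fun ω => I ω * P[fun ω => J ω * I ω|G] ω := by
  have hIb : ∀ ω, |I ω| ≤ 1 := by
    intro ω; rw [hI]; dsimp only; split_ifs <;> simp
  have hIm : Measurable I := hIH.measurable.mono hHm le_rfl
  have hJIb : ∀ ω, |J ω * I ω| ≤ 1 := fun ω => by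
    rw [abs_mul]; exact mul_le_one₀ (hJb ω) (abs_nonneg _) (hIb ω)
  have hpb := fd_bdd (m := G) P hIb
  have hDb := fd_bdd (m := G) P hJIb
  have hIi : Integrable I P := Integrable.of_bound hIm.aestronglyMeasurable 1
    (Eventually.of_forall hIb)
  have hJIi : Integrable (fun ω => J ω * I ω) P :=
    Integrable.of_bound (hJm.mul hIm).aestronglyMeasurable 1 (Eventually.of_forall hJIb)
  have hGH : G ≤ H := by
    rw [hG, hH]
    have : C = Prod.snd ∘ (fun ω => (A ω, C ω)) := rfl
    rw [this, ← MeasurableSpace.comap_comp]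
    exact MeasurableSpace.comap_mono measurable_snd.comap_le
  have hDm : StronglyMeasurable[G] (P[fun ω => J ω * I ω|G]) := stronglyMeasurable_condExp
  have hpm : StronglyMeasurable[G] (P[I|G]) := stronglyMeasurable_condExp
  have hi1 : Integrable (fun ω => I ω * P[fun ω => J ω * I ω|G] ω) P :=
    hIi.mul_bdd (hDm.mono hGm).aestronglyMeasurable hDb
  have hi2 : Integrable (fun ω => J ω * I ω * P[I|G] ω) P :=
    hJIi.mul_bdd (hpm.mono hGm).aestronglyMeasurable hpb
  symm
  refine ae_eq_condExp_of_forall_setIntegral_eq hHm hi2 (fun s _ _ => hi1.integrableOn) ?_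
    (hIH.mul (hDm.mono hGH)).aestronglyMeasurable
  intro s hs _
  rw [hH] at hs
  obtain ⟨t, ht, rfl⟩ := hs
  have hs' : MeasurableSet[G] (C ⁻¹' {c | (a, c) ∈ t}) := by
    rw [hG]; exact ⟨_, measurable_prodMk_left ht, rfl⟩
  have hs0 : MeasurableSet ((fun ω => (A ω, C ω)) ⁻¹' t) := (hA.prodMk hC) ht
  have key : ∀ F : Ω → ℝ, (∀ ω, A ω ≠ a → F ω = 0) →
      ∫ ω in (fun ω => (A ω, C ω)) ⁻¹' t, F ω ∂P = ∫ ω in C ⁻¹' {c | (a, c) ∈ t}, F ω ∂P := by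
    intro F hF
    rw [← integral_indicator hs0, ← integral_indicator (hGm _ hs')]
    congr 1
    ext ω
    by_cases hω : A ω = a
    · have e : (ω ∈ (fun ω => (A ω, C ω)) ⁻¹' t) ↔ (ω ∈ C ⁻¹' {c | (a, c) ∈ t}) := by
        change (A ω, C ω) ∈ t ↔ (a, C ω) ∈ t
        rw [hω]
      by_cases h : ω ∈ C ⁻¹' {c | (a, c) ∈ t}
      · rw [Set.indicator_of_mem h, Set.indicator_of_mem (e.2 h)]
      · rw [Set.indicator_of_notMem h, Set.indicator_of_notMem (fun h' => h (e.1 h'))]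
    · simp [Set.indicator, hF ω hω]
  rw [key, key]
  rotate_left
  · intro ω hω; simp [hI, hω]
  · intro ω hω; simp [hI, hω]
  rw [← setIntegral_condExp hGm hi1 hs', ← setIntegral_condExp hGm hi2 hs']
  refine integral_congr_ae (ae_restrict_of_ae ?_)
  filter_upwards [fd_pull hGm P hDm hDb hIi, fd_pull hGm P hpm hpb hJIi] with ω h1 h2
  rw [h1, h2, mul_comm]

lemma fd_key {Ω 𝓒 : Type*} [MeasurableSpace 𝓒] {G H m0 : MeasurableSpace Ω} (P : Measure Ω)
    [IsProbabilityMeasure P] {A : Ω → ℝ} {C : Ω → 𝓒} (hA : Measurable A) (hC : Measurable C)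
    (hG : G = MeasurableSpace.comap C inferInstance)
    (hH : H = MeasurableSpace.comap (fun ω => (A ω, C ω)) inferInstance)
    (a : ℝ) {I J W : Ω → ℝ} (hI : I = fun ω => if A ω = a then (1:ℝ) else 0)
    (hJm : Measurable J) (hJb : ∀ ω, |J ω| ≤ 1) (hW : Integrable W P)
    (hci : P[fun ω => W ω * J ω|H] =ᵐ[P] fun ω => P[W|H] ω * P[J|H] ω) :
    ∀ᵐ ω ∂P, P[fun ω => W ω * (J ω * I ω)|G] ω * P[I|G] ω =
      P[fun ω => W ω * I ω|G] ω * P[fun ω => J ω * I ω|G] ω := by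
  have hGm : G ≤ m0 := by rw [hG]; exact hC.comap_le
  have hHm : H ≤ m0 := by rw [hH]; exact (hA.prodMk hC).comap_le
  have hIH : StronglyMeasurable[H] I := by
    have h1 : Measurable[H] (fun ω => (A ω, C ω)) := by
      rw [hH]; exact comap_measurable _
    have h2 : Measurable (fun x : ℝ × 𝓒 => if x.1 = a then (1:ℝ) else 0) :=
      Measurable.ite (measurable_fst (measurableSet_singleton a)) measurable_const measurable_const
    have := h2.comp h1
    rw [hI]
    exact Measurable.stronglyMeasurable this
  have hIb : ∀ ω, |I ω| ≤ 1 := by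
    intro ω; rw [hI]; dsimp only; split_ifs <;> simp
  have hIb' : ∀ᵐ ω ∂P, ‖I ω‖ ≤ 1 := Eventually.of_forall hIb
  have hIm : Measurable I := hIH.measurable.mono hHm le_rfl
  have hJIb : ∀ ω, |J ω * I ω| ≤ 1 := fun ω => by
    rw [abs_mul]; exact mul_le_one₀ (hJb ω) (abs_nonneg _) (hIb ω)
  have hpb := fd_bdd (m := G) P hIb
  have hDb := fd_bdd (m := G) P hJIb
  have hGH : G ≤ H := by
    rw [hG, hH]
    have : C = Prod.snd ∘ (fun ω => (A ω, C ω)) := rfl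
    rw [this, ← MeasurableSpace.comap_comp]
    exact MeasurableSpace.comap_mono measurable_snd.comap_le
  have hDm : StronglyMeasurable[G] (P[fun ω => J ω * I ω|G]) := stronglyMeasurable_condExp
  have hpm : StronglyMeasurable[G] (P[I|G]) := stronglyMeasurable_condExp
  have hJi : Integrable J P := Integrable.of_bound hJm.aestronglyMeasurable 1
    (Eventually.of_forall hJb)
  have hJIi : Integrable (fun ω => J ω * I ω) P :=
    Integrable.of_bound (hJm.mul hIm).aestronglyMeasurable 1 (Eventually.of_forall hJIb)
  have hWJ : Integrable (fun ω => W ω * J ω) P :=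
    hW.mul_bdd hJm.aestronglyMeasurable (Eventually.of_forall hJb)
  have hWI : Integrable (fun ω => W ω * I ω) P := hW.mul_bdd hIm.aestronglyMeasurable hIb'
  have hWJI : Integrable (fun ω => W ω * J ω * I ω) P :=
    hWJ.mul_bdd hIm.aestronglyMeasurable hIb'
  have e : (fun ω => W ω * (J ω * I ω)) = fun ω => W ω * J ω * I ω := by
    ext ω; ring
  rw [e]
  have L1 := fd_L1 P hA hC hG hH hGm hHm a hI hIH hJm hJb
  have hmain : P[fun ω => W ω * J ω * I ω * P[I|G] ω|H] =ᵐ[P]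
      P[fun ω => W ω * I ω * P[fun ω => J ω * I ω|G] ω|H] := by
    filter_upwards [L1, fd_pull hHm P (hpm.mono hGH) hpb hWJI, fd_pull hHm P hIH hIb' hWJ, hci,
      fd_pull hHm P hIH hIb' hJi, fd_pull hHm P (hpm.mono hGH) hpb hJIi,
      fd_pull hHm P (hDm.mono hGH) hDb hWI, fd_pull hHm P hIH hIb' hW]
      with ω h1 h2 h3 h4 h5 h6 h7 h8
    rw [h2, h3, h4, h7, h8]
    rw [h6, h5] at h1
    linear_combination (P[W|H] ω) * h1
  have h9 := condExp_congr_ae (m := G) hmain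
  filter_upwards [h9, condExp_condExp_of_le (μ := P)
      (f := fun ω => W ω * J ω * I ω * P[I|G] ω) hGH hHm,
    condExp_condExp_of_le (μ := P)
      (f := fun ω => W ω * I ω * P[fun ω => J ω * I ω|G] ω) hGH hHm,
    fd_pull hGm P hpm hpb hWJI, fd_pull hGm P hDm hDb hWI] with ω h1 h2 h3 h4 h5
  rw [← h4, ← h5, ← h2, ← h3, h1]


lemma fd_gamma {Ω 𝓒 : Type*} [MeasurableSpace 𝓒] {G H m0 : MeasurableSpace Ω} (P : Measure Ω)
    [IsProbabilityMeasure P] {A M Y W : Ω → ℝ} {C : Ω → 𝓒} (hA : Measurable A)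
    (hA01 : ∀ ω, A ω = 0 ∨ A ω = 1) (hM : Measurable M) (hC : Measurable C)
    (hG : G = MeasurableSpace.comap C inferInstance)
    (hH : H = MeasurableSpace.comap (fun ω => (A ω, C ω)) inferInstance)
    (m : ℝ) (hW : Integrable W P)
    (hYW : ∀ ω, M ω = m → Y ω = W ω)
    (hci : P[fun ω => W ω * (if M ω = m then (1:ℝ) else 0)|H] =ᵐ[P]
      fun ω => P[W|H] ω * P[fun ω => if M ω = m then (1:ℝ) else 0|H] ω)
    (hd : ∀ a ∈ ({0, 1} : Set ℝ), ∀ᵐ ω ∂P, 0 < (P[fun ω' => (if A ω' = a then (1 : ℝ) else 0) *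
        (if M ω' = m then (1 : ℝ) else 0)|G]) ω)
    (μmed : ℝ → Ω → ℝ)
    (hμmed : ∀ a, μmed a = fun ω =>
      (P[fun ω' => Y ω' * ((if M ω' = m then (1 : ℝ) else 0) *
        (if A ω' = a then (1 : ℝ) else 0))|G]) ω /
      (P[fun ω' => (if M ω' = m then (1 : ℝ) else 0) *
        (if A ω' = a then (1 : ℝ) else 0)|G]) ω) :
    ∀ᵐ ω ∂P, P[A|G] ω * μmed 1 ω + (1 - P[A|G] ω) * μmed 0 ω = P[W|G] ω := by
  have hGm : G ≤ m0 := by rw [hG]; exact hC.comap_le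
  have hJm : Measurable (fun ω => if M ω = m then (1:ℝ) else 0) :=
    Measurable.ite (hM (measurableSet_singleton m)) measurable_const measurable_const
  have hIm : ∀ a, Measurable (fun ω => if A ω = a then (1:ℝ) else 0) := fun a =>
    Measurable.ite (hA (measurableSet_singleton a)) measurable_const measurable_const
  have hIb : ∀ (X : Ω → ℝ) (a : ℝ) (ω : Ω), |if X ω = a then (1:ℝ) else 0| ≤ 1 := by
    intro X a ω; split_ifs <;> simp
  have hIi : ∀ a, Integrable (fun ω => if A ω = a then (1:ℝ) else 0) P := fun a =>
    Integrable.of_bound (hIm a).aestronglyMeasurable 1 (Eventually.of_forall (hIb A a))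
  have hWI : ∀ a, Integrable (fun ω => W ω * if A ω = a then (1:ℝ) else 0) P := fun a =>
    hW.mul_bdd (hIm a).aestronglyMeasurable (Eventually.of_forall (hIb A a))
  have key : ∀ a ∈ ({0, 1} : Set ℝ), ∀ᵐ ω ∂P,
      P[fun ω => if A ω = a then (1:ℝ) else 0|G] ω * μmed a ω =
        P[fun ω => W ω * if A ω = a then (1:ℝ) else 0|G] ω := by
    intro a haa
    have e1 : (fun ω' => Y ω' * ((if M ω' = m then (1 : ℝ) else 0) *
        (if A ω' = a then (1 : ℝ) else 0))) = fun ω' => W ω' * ((if M ω' = m then (1 : ℝ) else 0) *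
        (if A ω' = a then (1 : ℝ) else 0)) := by
      ext ω
      by_cases h : M ω = m
      · rw [hYW ω h]
      · simp [h]
    have e2 : (fun ω' => (if A ω' = a then (1 : ℝ) else 0) * (if M ω' = m then (1 : ℝ) else 0))
      = fun ω' => (if M ω' = m then (1 : ℝ) else 0) * (if A ω' = a then (1 : ℝ) else 0) := by
      ext ω; ring
    have hda := hd a haa
    rw [e2] at hda
    filter_upwards [hda, fd_key P hA hC hG hH a rfl hJm (hIb M m) hW hci] with ω h1 h2
    rw [hμmed, e1]
    dsimp only
    rw [← mul_div_assoc, div_eq_iff h1.ne', mul_comm, h2]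
  have eA : A = fun ω => if A ω = 1 then (1:ℝ) else 0 := by
    ext ω; rcases hA01 ω with h | h <;> simp [h]
  have e0 : (fun ω => if A ω = 0 then (1:ℝ) else 0)
      = (fun _ => (1:ℝ)) - fun ω => if A ω = 1 then (1:ℝ) else 0 := by
    ext ω; rcases hA01 ω with h | h <;> simp [h]
  have eW : W = (fun ω => W ω * if A ω = 1 then (1:ℝ) else 0)
      + fun ω => W ω * if A ω = 0 then (1:ℝ) else 0 := by
    ext ω; rcases hA01 ω with h | h <;> simp [h]
  have h0 := condExp_sub (integrable_const (1:ℝ)) (hIi 1) G (μ := P)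
  rw [← e0, condExp_const hGm] at h0
  have hs := condExp_add (hWI 1) (hWI 0) G (μ := P)
  rw [← eW] at hs
  have hAe : P[A|G] = P[fun ω => if A ω = 1 then (1:ℝ) else 0|G] := congrArg (fun f => P[f|G]) eA
  filter_upwards [key 0 (by simp), key 1 (by simp), h0, hs] with ω h1 h2 h3 h4
  rw [hAe, h4, Pi.add_apply, ← h1, ← h2, h3]
  rfl

lemma fd_p {Ω : Type*} {G m0 : MeasurableSpace Ω} (P : Measure Ω)
    [IsProbabilityMeasure P] (hGm : G ≤ m0) {A M M0 M1 Ma : Ω → ℝ} (hA : Measurable A)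
    (hM : Measurable M) (hM01 : ∀ ω, M ω = 0 ∨ M ω = 1)
    (hM0m : Measurable M0) (hM1m : Measurable M1)
    (hMam : Measurable Ma)
    (hMab : ∀ ω, Ma ω = 0 ∨ Ma ω = 1)
    (hb : CondIndepFun' G P (fun ω => (M0 ω, M1 ω)) A)
    (φ : ℝ × ℝ → ℝ) (hφ : Measurable φ) (hφM : ∀ ω, Ma ω = φ (M0 ω, M1 ω))
    (a : ℝ) (hMMa : ∀ ω, A ω = a → M ω = Ma ω)
    (hd : ∀ᵐ ω ∂P, 0 < (P[fun ω' => (if A ω' = a then (1 : ℝ) else 0) *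
        (if M ω' = 1 then (1 : ℝ) else 0)|G]) ω) :
    ∀ᵐ ω ∂P, (P[fun ω' => (if A ω' = a then (1 : ℝ) else 0) * M ω'|G]) ω /
      (P[fun ω' => (if A ω' = a then (1 : ℝ) else 0)|G]) ω = P[Ma|G] ω := by
  have hIm : Measurable (fun ω => if A ω = a then (1:ℝ) else 0) :=
    Measurable.ite (hA (measurableSet_singleton a)) measurable_const measurable_const
  have hIb : ∀ ω, |if A ω = a then (1:ℝ) else 0| ≤ 1 := by
    intro ω; split_ifs <;> simp
  have hIi : Integrable (fun ω => if A ω = a then (1:ℝ) else 0) P :=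
    Integrable.of_bound hIm.aestronglyMeasurable 1 (Eventually.of_forall hIb)
  have hMai : Integrable Ma P :=
    Integrable.of_bound hMam.aestronglyMeasurable 1 (Eventually.of_forall fun ω => by
      rcases hMab ω with h | h <;> simp [h])
  have eM : (fun ω' => (if A ω' = a then (1 : ℝ) else 0) * (if M ω' = 1 then (1 : ℝ) else 0))
      = fun ω' => (if A ω' = a then (1 : ℝ) else 0) * M ω' := by
    ext ω; rcases hM01 ω with h | h <;> simp [h]
  have eMa : (fun ω' => (if A ω' = a then (1 : ℝ) else 0) * M ω')
      = fun ω' => Ma ω' * (if A ω' = a then (1 : ℝ) else 0) := by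
    ext ω
    by_cases h : A ω = a
    · simp [h, hMMa ω h]
    · simp [h]
  rw [eM, eMa] at hd
  rw [eMa]
  have hMaeq : Ma = fun ω => φ (M0 ω, M1 ω) := funext hφM
  have hci := fd_ci hGm P (hM0m.prodMk hM1m) hA hb hφ
    (ψ := fun x => if x = a then (1:ℝ) else 0)
    (Measurable.ite (measurableSet_singleton a) measurable_const measurable_const)
    (by rw [← hMaeq]; exact hMai) hIb
  simp only [← hφM] at hci
  filter_upwards [hd, hci] with ω h1 h2
  rw [h2] at h1 ⊢
  rw [mul_div_assoc, div_self, mul_one]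
  intro h
  rw [h, mul_zero] at h1
  exact lt_irrefl _ h1

/-- **Identification of the average causal effect by the front-door functional**
(binary treatment and binary mediator).
Under consistency (`M = A·M₁ + (1-A)·M₀`, `Y = M·Ẏ₁ + (1-M)·Ẏ₀`), the front-door conditional
independence assumptions (a)–(c) given `𝒢 = σ(C)` and `ℋ = σ(A, C)`, and positivity (d), the
average causal effect of `A` on `Y` is identified by the front-door functional:
`E[(M₁ - M₀)(Ẏ₁ - Ẏ₀)] = E[(p₁ - p₀)(γ₁ - γ₀)]`, where `π = E[A | 𝒢]`,
`p_a = E[1{A=a} M | 𝒢]/E[1{A=a} | 𝒢]`, `μ_{m,a} = E[Y 1{M=m,A=a} | 𝒢]/E[1{M=m,A=a} | 𝒢]`,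
and `γ_m = π μ_{m,1} + (1-π) μ_{m,0}`. -/
theorem frontdoor_identification
    {Ω 𝓒 : Type*} [MeasurableSpace Ω] [MeasurableSpace 𝓒] [StandardBorelSpace 𝓒]
    (Pr : Measure Ω) [IsProbabilityMeasure Pr]
    (C : Ω → 𝓒) (hC : Measurable C)
    (A : Ω → ℝ) (hA : Measurable A) (hA01 : ∀ ω, A ω = 0 ∨ A ω = 1)
    (M : Ω → ℝ) (hM : Measurable M) (hM01 : ∀ ω, M ω = 0 ∨ M ω = 1)
    (Y : Ω → ℝ) (hYm : Measurable Y) (hY : Integrable Y Pr)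
    (M0 M1 : Ω → ℝ) (hM0m : Measurable M0) (hM1m : Measurable M1)
    (hM001 : ∀ ω, M0 ω = 0 ∨ M0 ω = 1) (hM101 : ∀ ω, M1 ω = 0 ∨ M1 ω = 1)
    (Ydot0 Ydot1 : Ω → ℝ) (hYd0m : Measurable Ydot0) (hYd1m : Measurable Ydot1)
    (hYd0 : Integrable Ydot0 Pr) (hYd1 : Integrable Ydot1 Pr)
    -- consistency
    (hMdef : M = fun ω => A ω * M1 ω + (1 - A ω) * M0 ω)
    (hYdef : Y = fun ω => M ω * Ydot1 ω + (1 - M ω) * Ydot0 ω)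
    (𝒢 ℋ : MeasurableSpace Ω)
    (h𝒢 : 𝒢 = MeasurableSpace.comap C inferInstance)
    (hℋ : ℋ = MeasurableSpace.comap (fun ω => (A ω, C ω)) inferInstance)
    -- (a) (Ẏ₀, Ẏ₁) ⫫ (M₀, M₁) given 𝒢
    (ha : CondIndepFun' 𝒢 Pr (fun ω => (Ydot0 ω, Ydot1 ω)) (fun ω => (M0 ω, M1 ω)))
    -- (b) (M₀, M₁) ⫫ A given 𝒢
    (hb : CondIndepFun' 𝒢 Pr (fun ω => (M0 ω, M1 ω)) A)
    -- (c) (Ẏ₀, Ẏ₁) ⫫ M given ℋ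
    (hc : CondIndepFun' ℋ Pr (fun ω => (Ydot0 ω, Ydot1 ω)) M)
    -- (d) positivity
    (hd : ∃ ε : ℝ, 0 < ε ∧ ∀ a ∈ ({0, 1} : Set ℝ), ∀ m ∈ ({0, 1} : Set ℝ),
      ∀ᵐ ω ∂Pr, ε ≤ (Pr[fun ω' => (if A ω' = a then (1 : ℝ) else 0) *
        (if M ω' = m then (1 : ℝ) else 0)|𝒢]) ω)
    -- derived 𝒢-measurable quantities
    (π : Ω → ℝ) (hπ : π = Pr[A|𝒢])
    (p : ℝ → Ω → ℝ)
    (hp : ∀ a, p a = fun ω => (Pr[fun ω' => (if A ω' = a then (1 : ℝ) else 0) * M ω'|𝒢]) ω /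
      (Pr[fun ω' => (if A ω' = a then (1 : ℝ) else 0)|𝒢]) ω)
    (μmed : ℝ → ℝ → Ω → ℝ)
    (hμmed : ∀ m a, μmed m a = fun ω =>
      (Pr[fun ω' => Y ω' * ((if M ω' = m then (1 : ℝ) else 0) *
        (if A ω' = a then (1 : ℝ) else 0))|𝒢]) ω /
      (Pr[fun ω' => (if M ω' = m then (1 : ℝ) else 0) *
        (if A ω' = a then (1 : ℝ) else 0)|𝒢]) ω)
    (γ : ℝ → Ω → ℝ)
    (hγ : ∀ m, γ m = fun ω => π ω * μmed m 1 ω + (1 - π ω) * μmed m 0 ω) :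
    ∫ ω, (M1 ω - M0 ω) * (Ydot1 ω - Ydot0 ω) ∂Pr
      = ∫ ω, (p 1 ω - p 0 ω) * (γ 1 ω - γ 0 ω) ∂Pr := by
  obtain ⟨ε, hε, hd⟩ := hd
  have hGm := hC.comap_le
  have hHm := (hA.prodMk hC).comap_le
  have hMi : ∀ (m : ℝ), Measurable (fun x : ℝ => if x = m then (1:ℝ) else 0) := fun m =>
    Measurable.ite (measurableSet_singleton m) measurable_const measurable_const
  have hIb : ∀ (X : Ω → ℝ) (a : ℝ) (ω : Ω), |if X ω = a then (1:ℝ) else 0| ≤ 1 := by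
    intro X a ω; split_ifs <;> simp
  have hci1 := fd_ci (hℋ.le.trans hHm) Pr (hYd0m.prodMk hYd1m) hM hc (φ := Prod.snd)
    measurable_snd (hMi 1) hYd1 (hIb M 1)
  have hci0 := fd_ci (hℋ.le.trans hHm) Pr (hYd0m.prodMk hYd1m) hM hc (φ := Prod.fst)
    measurable_fst (hMi 0) hYd0 (hIb M 0)
  have hciM := fd_ci (h𝒢.le.trans hGm) Pr (hYd0m.prodMk hYd1m) (hM0m.prodMk hM1m) ha
    (φ := fun y => y.2 - y.1) (ψ := fun x => x.2 - x.1)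
    (measurable_snd.sub measurable_fst) (measurable_snd.sub measurable_fst) (hYd1.sub hYd0)
    (fun ω => by rcases hM001 ω with h | h <;> rcases hM101 ω with h' | h' <;> simp [h, h'])
  have g1 := fd_gamma (Y := Y) Pr hA hA01 hM hC h𝒢 hℋ 1 hYd1
    (fun ω h => by rw [hYdef]; simp [h]) hci1
    (fun a haa => (hd a haa 1 (by simp)).mono fun ω h => hε.trans_le h) (μmed 1) (hμmed 1)
  have g0 := fd_gamma (Y := Y) Pr hA hA01 hM hC h𝒢 hℋ 0 hYd0
    (fun ω h => by rw [hYdef]; simp [h]) hci0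
    (fun a haa => (hd a haa 0 (by simp)).mono fun ω h => hε.trans_le h) (μmed 0) (hμmed 0)
  have p1 := fd_p Pr (h𝒢.le.trans hGm) hA hM hM01 hM0m hM1m hM1m hM101 hb Prod.snd measurable_snd
    (fun ω => rfl) 1 (fun ω h => by rw [hMdef]; simp [h])
    ((hd 1 (by simp) 1 (by simp)).mono fun ω h => hε.trans_le h)
  have p0 := fd_p Pr (h𝒢.le.trans hGm) hA hM hM01 hM0m hM1m hM0m hM001 hb Prod.fst measurable_fst
    (fun ω => rfl) 0 (fun ω h => by rw [hMdef]; simp [h])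
    ((hd 0 (by simp) 1 (by simp)).mono fun ω h => hε.trans_le h)
  have hM1i : Integrable M1 Pr := Integrable.of_bound hM1m.aestronglyMeasurable 1
    (Eventually.of_forall fun ω => by rcases hM101 ω with h | h <;> simp [h])
  have hM0i : Integrable M0 Pr := Integrable.of_bound hM0m.aestronglyMeasurable 1
    (Eventually.of_forall fun ω => by rcases hM001 ω with h | h <;> simp [h])
  rw [← integral_condExp (h𝒢.le.trans hGm)]
  refine integral_congr_ae ?_
  have e : (fun ω => (M1 ω - M0 ω) * (Ydot1 ω - Ydot0 ω))
      = fun ω => (Ydot1 ω - Ydot0 ω) * (M1 ω - M0 ω) := by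
    ext ω; ring
  rw [e]
  filter_upwards [hciM, g1, g0, p1, p0, condExp_sub hM1i hM0i 𝒢, condExp_sub hYd1 hYd0 𝒢]
    with ω h1 h2 h3 h4 h5 h6 h7
  have h6' : Pr[fun ω => M1 ω - M0 ω|𝒢] ω = Pr[M1|𝒢] ω - Pr[M0|𝒢] ω := h6
  have h7' : Pr[fun ω => Ydot1 ω - Ydot0 ω|𝒢] ω = Pr[Ydot1|𝒢] ω - Pr[Ydot0|𝒢] ω := h7
  rw [h1, hγ, hγ, hp, hp, hπ]
  dsimp only
  rw [h2, h3, h4, h5, h6', h7', mul_comm]
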